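/- Let n ≥ 1 and 0 ≤ t ≤ C(n,2) be integers. Then ∑_{i=0}^{t} I_n(i) = C(n+t, t) + ∑_{j=1}^{n} ∑_{k=C(j+1,2)}^{C(n+1,2)} (−1)^j · D(n,j,k) · C₀(t − k + n, n), where D(n,j,k) is the number of j-element subsets of {1,…,n} whose elements sum to k, and C₀(a,b) denotes the restricted binomial coefficient which equals C(a,b) when a ≥ b and 0 otherwise. -/

import Mathlib

/-- The number of inversions of a permutation of `Fin n`. -/
def invCount {n : ℕ} (π : Equiv.Perm (Fin n)) : ℕ :=
  ((Finset.univ : Finset (Fin n × Fin n)).filter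
    (fun p => p.1 < p.2 ∧ π p.2 < π p.1)).card

/-- `I n t`: the number of permutations of `{1,…,n}` with exactly `t` inversions. -/
def invNum (n t : ℕ) : ℕ :=
  ((Finset.univ : Finset (Equiv.Perm (Fin n))).filter (fun π => invCount π = t)).card

/-- `D n j k`: the number of `j`-element subsets of `{1,…,n}` whose elements sum to `k`. -/
def subsetSumCount (n j k : ℕ) : ℕ :=
  ((Finset.powersetCard j (Finset.Icc 1 n)).filter (fun s => ∑ i ∈ s, i = k)).card

/-- Restricted binomial coefficient: `C₀(a,b) = C(a,b)` when `a ≥ b`, and `0` otherwise. -/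
def C0 (a : ℤ) (b : ℕ) : ℤ := if (b : ℤ) ≤ a then ((a.toNat).choose b : ℤ) else 0

open Finset

/-- The permutation of `Fin (n + 1)` sending `0` to `p` and acting on the remaining points as `e`,
up to order isomorphism. -/
def consPerm {n : ℕ} (p : Fin (n + 1)) (e : Equiv.Perm (Fin n)) : Equiv.Perm (Fin (n + 1)) :=
  (finSuccEquiv' 0).trans ((Equiv.optionCongr e).trans (finSuccEquiv' p).symm)

theorem consPerm_zero {n : ℕ} (p : Fin (n + 1)) (e : Equiv.Perm (Fin n)) :
    consPerm p e 0 = p := by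
  simp [consPerm]

theorem consPerm_succ {n : ℕ} (p : Fin (n + 1)) (e : Equiv.Perm (Fin n)) (i : Fin n) :
    consPerm p e i.succ = p.succAbove (e i) := by
  have h : finSuccEquiv' (0 : Fin (n + 1)) i.succ = some i := by
    rw [← Fin.succAbove_zero_apply, finSuccEquiv'_succAbove]
  simp [consPerm, h]

theorem bijective_consPerm (n : ℕ) :
    Function.Bijective (fun x : Fin (n + 1) × Equiv.Perm (Fin n) => consPerm x.1 x.2) := by
  rw [Fintype.bijective_iff_injective_and_card]
  refine ⟨?_, by simp [Fintype.card_perm, Nat.factorial_succ]⟩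
  rintro ⟨p, e⟩ ⟨q, f⟩ h
  obtain rfl : p = q := by
    simpa only [consPerm_zero] using congrArg (fun π : Equiv.Perm (Fin (n + 1)) => π 0) h
  refine Prod.ext rfl (Equiv.ext fun i => ?_)
  have hi := congrArg (fun π : Equiv.Perm (Fin (n + 1)) => π i.succ) h
  simp only [consPerm_succ] at hi
  exact Fin.succAbove_right_injective hi

theorem invCount_eq_sum {n : ℕ} (π : Equiv.Perm (Fin n)) :
    invCount π = ∑ i, ∑ j, if i < j ∧ π j < π i then 1 else 0 := by
  rw [invCount, card_filter, Fintype.sum_prod_type]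

theorem invCount_consPerm {n : ℕ} (p : Fin (n + 1)) (e : Equiv.Perm (Fin n)) :
    invCount (consPerm p e) = p + invCount e := by
  have h : ∑ j, (if p.succAbove (e j) < p then 1 else 0) = (p : ℕ) := by
    rw [Equiv.sum_comp e fun j => if p.succAbove j < p then 1 else 0]
    simp only [Fin.succAbove_lt_iff_castSucc_lt]
    simp only [Fin.lt_def, Fin.val_castSucc]
    rw [Fin.sum_univ_eq_sum_range (fun j => if j < (p : ℕ) then 1 else 0), ← card_filter]
    have : (range n).filter (· < (p : ℕ)) = range p := by
      ext; simp; omega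
    rw [this, card_range]
  simp only [invCount_eq_sum, Fin.sum_univ_succ (n := n), consPerm_zero, consPerm_succ,
    Fin.succ_lt_succ_iff, Fin.succAbove_lt_succAbove_iff, Fin.succ_pos, true_and, h,
    false_and, if_false, zero_add, Fin.not_lt_zero]

open PowerSeries

theorem sum_X_pow_invCount_mul (n : ℕ) :
    (∑ π : Equiv.Perm (Fin n), (X : ℤ⟦X⟧) ^ invCount π) * (1 - X) ^ n =
      ∏ i ∈ Icc 1 n, (1 - X ^ i) := by
  induction n with
  | zero => simp [invCount]
  | succ n ih =>
    rw [← (bijective_consPerm n).sum_comp, Fintype.sum_prod_type, prod_Icc_succ_top (by omega), ← ih,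
      ← mul_neg_geom_sum, ← Fin.sum_univ_eq_sum_range]
    simp only [invCount_consPerm, pow_add, ← mul_sum, ← sum_mul]
    ring

theorem coeff_sum_X_pow_invCount (n t : ℕ) :
    coeff t (∑ π : Equiv.Perm (Fin n), (X : ℤ⟦X⟧) ^ invCount π) = invNum n t := by
  simp [coeff_X_pow, invNum, eq_comm]

theorem sum_range_invNum_eq_coeff (n t : ℕ) :
    ∑ i ∈ range (t + 1), (invNum n i : ℤ) =
      coeff t ((∏ i ∈ Icc 1 n, (1 - (X : ℤ⟦X⟧) ^ i)) * (PowerSeries.mk fun m => ((n + m).choose n : ℤ))) := by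
  have h : (∏ i ∈ Icc 1 n, (1 - (X : ℤ⟦X⟧) ^ i)) * (PowerSeries.mk fun m => ((n + m).choose n : ℤ)) =
      (∑ π : Equiv.Perm (Fin n), (X : ℤ⟦X⟧) ^ invCount π) * PowerSeries.mk 1 := by
    rw [← mk_one_pow_eq_mk_choose_add, ← sum_X_pow_invCount_mul, pow_succ, mul_assoc,
      ← mul_assoc ((1 - X) ^ n), ← mul_pow, mul_comm (1 - X), mk_one_mul_one_sub_eq_one,
      one_pow, one_mul]
  rw [h, coeff_mul, Nat.sum_antidiagonal_eq_sum_range_succ_mk]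
  simp only [coeff_sum_X_pow_invCount, coeff_mk, Pi.one_apply, mul_one]

theorem sum_range_invNum_eq_sum_powerset (n t : ℕ) :
    ∑ i ∈ range (t + 1), (invNum n i : ℤ) =
      ∑ s ∈ (Icc 1 n).powerset, (-1) ^ #s * C0 ((t : ℤ) - (∑ i ∈ s, i : ℕ) + n) n := by
  rw [sum_range_invNum_eq_coeff, prod_sub, sum_mul, map_sum]
  refine sum_congr rfl fun s _ => ?_
  have hC : coeff t (X ^ (∑ i ∈ s, i) * (PowerSeries.mk fun m => ((n + m).choose n : ℤ))) =
      C0 ((t : ℤ) - (∑ i ∈ s, i : ℕ) + n) n := by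
    rw [coeff_X_pow_mul', coeff_mk, C0]
    refine if_ctx_congr (by omega) (fun h => ?_) fun _ => rfl
    congr 2
    omega
  have hsign : ((-1) ^ #s : ℤ⟦X⟧) = C ((-1) ^ #s) := by simp
  rw [prod_const_one, mul_one, prod_pow_eq_pow_sum, hsign, mul_assoc, coeff_C_mul, hC]

theorem sum_Icc_one_id (n : ℕ) : ∑ i ∈ Icc 1 n, i = (n + 1).choose 2 := by
  induction n with
  | zero => simp
  | succ n ih =>
    rw [sum_Icc_succ_top (by omega), ih, Nat.choose_succ_succ' (n + 1) 1]
    simp [add_comm]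

theorem choose_two_le_sum (s : Finset ℕ) (hs : 0 ∉ s) : (#s + 1).choose 2 ≤ ∑ i ∈ s, i := by
  induction s using Finset.induction_on_max with
  | empty => simp
  | insert a s ha ih =>
    have hna : a ∉ s := fun h => lt_irrefl a (ha a h)
    rw [mem_insert, not_or] at hs
    have hcard : #s + 1 ≤ a := by
      have hsub : insert 0 s ⊆ range a := by
        intro x hx
        rw [mem_insert] at hx
        rw [mem_range]
        rcases hx with rfl | hx
        · omega
        · exact ha x hx
      simpa [card_insert_of_notMem hs.2] using card_le_card hsub
    rw [card_insert_of_notMem hna, sum_insert hna, Nat.choose_succ_succ' (#s + 1) 1,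
      Nat.choose_one_right]
    exact add_le_add hcard (ih hs.2)

theorem sum_powersetCard_C0 (n t j : ℕ) :
    ∑ s ∈ powersetCard j (Icc 1 n), (-1) ^ #s * C0 ((t : ℤ) - (∑ i ∈ s, i : ℕ) + n) n =
      ∑ k ∈ Icc ((j + 1).choose 2) ((n + 1).choose 2),
        (-1) ^ j * (subsetSumCount n j k : ℤ) * C0 ((t : ℤ) - k + n) n := by
  have hmaps : ∀ s ∈ powersetCard j (Icc 1 n),
      ∑ i ∈ s, i ∈ Icc ((j + 1).choose 2) ((n + 1).choose 2) := by
    intro s hs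
    obtain ⟨hsub, rfl⟩ := mem_powersetCard.1 hs
    refine mem_Icc.2 ⟨choose_two_le_sum s fun h => by simpa using hsub h, ?_⟩
    rw [← sum_Icc_one_id]
    exact sum_le_sum_of_subset hsub
  rw [← sum_fiberwise_of_maps_to hmaps]
  refine sum_congr rfl fun k _ => ?_
  rw [subsetSumCount, mul_right_comm, ← nsmul_eq_mul', ← sum_const]
  refine sum_congr rfl fun s hs => ?_
  obtain ⟨hcard, rfl⟩ := mem_filter.1 hs
  rw [(mem_powersetCard.1 hcard).2]

theorem sum_invNum_eq (n t : ℕ) (hn : 1 ≤ n) (ht : t ≤ n.choose 2) :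
    (∑ i ∈ Finset.range (t + 1), (invNum n i : ℤ)) =
      ((n + t).choose t : ℤ) +
        ∑ j ∈ Finset.Icc 1 n, ∑ k ∈ Finset.Icc ((j + 1).choose 2) ((n + 1).choose 2),
          (-1) ^ j * (subsetSumCount n j k : ℤ) * C0 ((t : ℤ) - k + n) n := by
  have hempty : C0 ((t : ℤ) + n) n = (n + t).choose t := by
    rw [C0, if_pos (by omega), add_comm n t, Nat.choose_symm_add]
    rfl
  rw [sum_range_invNum_eq_sum_powerset, sum_powerset, Nat.card_Icc, Nat.add_sub_cancel,
    range_eq_Ico, sum_eq_sum_Ico_succ_bot (Nat.succ_pos n), powersetCard_zero, sum_singleton]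
  simp only [card_empty, pow_zero, sum_empty, Nat.cast_zero, sub_zero, one_mul, hempty, zero_add]
  exact congrArg _ (sum_congr rfl fun j _ => sum_powersetCard_C0 n t j)
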